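/- The Deguchi–Martin face weights satisfy the face-type Yang–Baxter (star-triangle) relation: for all state vectors a⃗, b⃗, c⃗, d⃗, e⃗, f⃗ ∈ ℤ² and all u₁, u₂, u₃ ∈ ℂ for which all denominators appearing in the weights are nonzero, Σ_{g⃗∈ℤ²} W(f⃗,g⃗;a⃗,b⃗|u₁|u₃) W(e⃗,d⃗;f⃗,g⃗|u₂|u₃) W(d⃗,c⃗;g⃗,b⃗|u₂|u₁) = Σ_{g⃗∈ℤ²} W(e⃗,d⃗;g⃗,c⃗|u₁|u₃) W(g⃗,c⃗;a⃗,b⃗|u₂|u₃) W(e⃗,g⃗;f⃗,a⃗|u₂|u₁), where each sum has only finitely many nonzero terms. -/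

import Mathlib

open Complex

noncomputable section

/-- The half period magnitude `K₁` for elliptic nome `q`. -/
def Kone (q : ℝ) : ℝ :=
  Real.pi / 2 * ∏' n : ℕ,
    ((1 + q ^ (2 * n + 1)) / (1 - q ^ (2 * n + 1)) *
      ((1 - q ^ (2 * n + 2)) / (1 + q ^ (2 * n + 2)))) ^ 2

/-- The half period magnitude `K₂` for elliptic nome `q`. -/
def Ktwo (q : ℝ) : ℝ := -(Kone q / Real.pi) * Real.log q

/-- The elliptic theta function `H`. -/
def theta (q : ℝ) (u : ℂ) : ℂ :=
  2 * (q : ℂ) ^ (1 / 4 : ℂ) * Complex.sin (Real.pi * u / (2 * (Kone q : ℂ))) *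
    ∏' n : ℕ,
      ((1 - 2 * (q : ℂ) ^ (2 * n + 2) * Complex.cos (Real.pi * u / (Kone q : ℂ)) +
          (q : ℂ) ^ (4 * n + 4)) * (1 - (q : ℂ) ^ (2 * n + 2)))

/-- The bracket `[u] = H(λu)`. -/
def brak (q : ℝ) (lam : ℂ) (u : ℂ) : ℂ := theta q (lam * u)

/-- Unit vector ê₁. -/
def e1 : ℤ × ℤ := (1, 0)

/-- Unit vector ê₂. -/
def e2 : ℤ × ℤ := (0, 1)

/-- The scalar `a₁₂ = a₁ + a₂ + ω₁₂` attached to a state vector. -/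
def aSc (ω12 : ℂ) (a : ℤ × ℤ) : ℂ := (a.1 : ℂ) + (a.2 : ℂ) + ω12

/-- The face weights of the Deguchi-Martin model. -/
def faceW (q : ℝ) (lam ω12 : ℂ) (a b c d : ℤ × ℤ) (u v : ℂ) : ℂ :=
  if b = a + e1 ∧ c = a + e1 ∧ d = a + e1 + e1 then
    brak q lam (1 + (u - v)) / brak q lam 1
  else if b = a + e2 ∧ c = a + e2 ∧ d = a + e2 + e2 then
    brak q lam (1 - (u - v)) / brak q lam 1
  else if b = a + e2 ∧ c = a + e1 ∧ d = a + e1 + e2 then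
    brak q lam (u - v) * brak q lam (aSc ω12 a - 1) / (brak q lam 1 * brak q lam (aSc ω12 a))
  else if b = a + e1 ∧ c = a + e2 ∧ d = a + e1 + e2 then
    brak q lam (u - v) * brak q lam (-aSc ω12 a - 1) / (brak q lam 1 * brak q lam (-aSc ω12 a))
  else if b = a + e1 ∧ c = a + e1 ∧ d = a + e1 + e2 then
    brak q lam (aSc ω12 a - (u - v)) / brak q lam (aSc ω12 a)
  else if b = a + e2 ∧ c = a + e2 ∧ d = a + e1 + e2 then
    brak q lam (-aSc ω12 a - (u - v)) / brak q lam (-aSc ω12 a)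
  else 0

set_option linter.unusedSimpArgs false
set_option linter.unusedVariables false

/-- An odd function satisfying the three-term (Weierstrass) identity. -/
structure IsTh (B : ℂ → ℂ) : Prop where
  odd : ∀ x, B (-x) = -B x
  w3 : ∀ a b c d, B (a+b) * B (a-b) * B (c+d) * B (c-d) + B (a+c) * B (a-c) * B (d+b) * B (d-b)
    + B (a+d) * B (a-d) * B (b+c) * B (b-c) = 0

lemma IsTh.w3e {B : ℂ → ℂ} (hB : IsTh B) (x1 x2 x3 x4 y1 y2 y3 y4 z1 z2 z3 z4 : ℂ)
    (h : y1 = (x1+x2+x3+x4)/2 ∧ y2 = (x1+x2-x3-x4)/2 ∧ y3 = (x1-x2+x3-x4)/2 ∧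
      y4 = (x3-x4-x1+x2)/2 ∧ z1 = (x1+x2+x3-x4)/2 ∧ z2 = (x1+x2-x3+x4)/2 ∧
      z3 = (x1-x2+x3+x4)/2 ∧ z4 = (x1-x2-x3-x4)/2) :
    B x1 * B x2 * B x3 * B x4 + B y1 * B y2 * B y3 * B y4 + B z1 * B z2 * B z3 * B z4 = 0 := by
  obtain ⟨rfl, rfl, rfl, rfl, rfl, rfl, rfl, rfl⟩ := h
  convert hB.w3 ((x1+x2)/2) ((x1-x2)/2) ((x3+x4)/2) ((x3-x4)/2) using 7 <;> ring

def wD1 (B : ℂ → ℂ) (x : ℂ) : ℂ := B (1 + x) / B 1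
def wD2 (B : ℂ → ℂ) (x : ℂ) : ℂ := B (1 - x) / B 1
def wP1 (B : ℂ → ℂ) (s x : ℂ) : ℂ := B x * B (s - 1) / (B 1 * B s)
def wP2 (B : ℂ → ℂ) (s x : ℂ) : ℂ := B x * B (-s - 1) / (B 1 * B (-s))
def wR1 (B : ℂ → ℂ) (s x : ℂ) : ℂ := B (s - x) / B s
def wR2 (B : ℂ → ℂ) (s x : ℂ) : ℂ := B (-s - x) / B (-s)

lemma IsTh.P2 {B : ℂ → ℂ} (hB : IsTh B) (s x : ℂ) :
    wP2 B s x = B x * B (s + 1) / (B 1 * B s) := by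
  unfold wP2
  rw [show -s - 1 = -(s+1) by ring, hB.odd, hB.odd, mul_neg, mul_neg, neg_div_neg_eq]

lemma IsTh.R2 {B : ℂ → ℂ} (hB : IsTh B) (s x : ℂ) :
    wR2 B s x = B (s + x) / B s := by
  unfold wR2
  rw [show -s - x = -(s+x) by ring, hB.odd, hB.odd, neg_div_neg_eq]


lemma ybe_112_112 {B : ℂ → ℂ} (hB : IsTh B) {s u v w : ℂ} (hw : w = u + v)
    (h1 : B 1 ≠ 0) (hs : B s ≠ 0) (hs1 : B (s+1) ≠ 0) :
    wR1 B (s+1) v * wD1 B w * wR1 B (s+1) u + wP1 B (s+1) v * wR1 B s w * wP2 B (s+1) u =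
      wD1 B v * wR1 B (s+1) w * wD1 B u := by
  have h := hB.w3e (s-w) (v) (u) (s+2) (s+1) (-(1+u)) (-(1+v)) (-(s+1-w)) (-(1)) (s+1-u) (s+1-v) (-(1+w))
    (by subst hw; refine ⟨?_, ?_, ?_, ?_, ?_, ?_, ?_, ?_⟩ <;> ring)
  simp only [hB.odd] at h
  simp only [hB.P2, hB.R2, wD1, wD2, wP1, wR1, show s + 1 - 1 = s by ring,
    show s + 1 + 1 = s + 2 by ring]
  linear_combination (norm := skip) (1/(B 1^2*B (s+1)^2)) * h
  field_simp
  ring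

lemma ybe_112_121 {B : ℂ → ℂ} (hB : IsTh B) {s u v w : ℂ} (hw : w = u + v)
    (h1 : B 1 ≠ 0) (hs : B s ≠ 0) (hs1 : B (s+1) ≠ 0) :
    wP2 B (s+1) v * wD1 B w * wR1 B (s+1) u + wR2 B (s+1) v * wR1 B s w * wP2 B (s+1) u =
      wD1 B v * wP2 B (s+1) w * wR1 B s u := by
  have h := hB.w3e (s-w) (s+1+v) (u) (1) (s+1) (s-u) (-(1+v)) (w) (s) (s+1-u) (-(v)) (-(1+w))
    (by subst hw; refine ⟨?_, ?_, ?_, ?_, ?_, ?_, ?_, ?_⟩ <;> ring)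
  simp only [hB.odd] at h
  simp only [hB.P2, hB.R2, wD1, wD2, wP1, wR1, show s + 1 - 1 = s by ring,
    show s + 1 + 1 = s + 2 by ring]
  linear_combination (norm := skip) (B (s+2)/(B s*B 1^2*B (s+1)^2)) * h
  field_simp
  ring

lemma ybe_112_211 {B : ℂ → ℂ} (hB : IsTh B) {s u v w : ℂ} (hw : w = u + v)
    (h1 : B 1 ≠ 0) (hs : B s ≠ 0) (hs1 : B (s+1) ≠ 0) :
    wD1 B v * wP2 B s w * wP2 B (s+1) u =
      wD1 B v * wP2 B (s+1) w * wP2 B s u := by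
  simp only [hB.P2, hB.R2, wD1, wD2, wP1, wR1, show s + 1 - 1 = s by ring,
    show s + 1 + 1 = s + 2 by ring]
  ring

lemma ybe_121_112 {B : ℂ → ℂ} (hB : IsTh B) {s u v w : ℂ} (hw : w = u + v)
    (h1 : B 1 ≠ 0) (hs : B s ≠ 0) (hs1 : B (s+1) ≠ 0) :
    wR1 B (s+1) v * wD1 B w * wP1 B (s+1) u + wP1 B (s+1) v * wR1 B s w * wR2 B (s+1) u =
      wR1 B s v * wP1 B (s+1) w * wD1 B u := by
  have h := hB.w3e (s-w) (v) (s+1+u) (1) (s+1) (-(1+u)) (s-v) (w) (s) (-(u)) (s+1-v) (-(1+w))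
    (by subst hw; refine ⟨?_, ?_, ?_, ?_, ?_, ?_, ?_, ?_⟩ <;> ring)
  simp only [hB.odd] at h
  simp only [hB.P2, hB.R2, wD1, wD2, wP1, wR1, show s + 1 - 1 = s by ring,
    show s + 1 + 1 = s + 2 by ring]
  linear_combination (norm := skip) (1/(B 1^2*B (s+1)^2)) * h
  field_simp
  ring

lemma ybe_121_121 {B : ℂ → ℂ} (hB : IsTh B) {s u v w : ℂ} (hw : w = u + v)
    (h1 : B 1 ≠ 0) (hs : B s ≠ 0) (hs1 : B (s+1) ≠ 0) :
    wP2 B (s+1) v * wD1 B w * wP1 B (s+1) u + wR2 B (s+1) v * wR1 B s w * wR2 B (s+1) u =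
      wR1 B s v * wR2 B (s+1) w * wR1 B s u + wP2 B s v * wD1 B w * wP1 B s u := by
  have h := hB.w3e (s-v) (s-u) (s+1+w) (s+1) (2*s+1) (-(1+w)) (u) (v) (s) (s-w) (s+1+u) (-(s+1+v))
    (by subst hw; refine ⟨?_, ?_, ?_, ?_, ?_, ?_, ?_, ?_⟩ <;> ring)
  simp only [hB.odd] at h
  have h3 := hB.w3e (s+2) (s) (s) (s) (2*s+1) (1) (1) (-(1)) (s+1) (s+1) (s+1) (-(s-1))
    (by subst hw; refine ⟨?_, ?_, ?_, ?_, ?_, ?_, ?_, ?_⟩ <;> ring)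
  simp only [hB.odd] at h3
  simp only [hB.P2, hB.R2, wD1, wD2, wP1, wR1, show s + 1 - 1 = s by ring,
    show s + 1 + 1 = s + 2 by ring]
  linear_combination (norm := skip) (B (1+w)*B v*B u/(B 1^3*B s^2*B (s+1)^2)) * h3 - (1/(B s^2*B (s+1)^2)) * h
  field_simp
  ring

lemma ybe_121_211 {B : ℂ → ℂ} (hB : IsTh B) {s u v w : ℂ} (hw : w = u + v)
    (h1 : B 1 ≠ 0) (hs : B s ≠ 0) (hs1 : B (s+1) ≠ 0) :
    wD1 B v * wP2 B s w * wR2 B (s+1) u =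
      wR1 B s v * wR2 B (s+1) w * wP2 B s u + wP2 B s v * wD1 B w * wR2 B s u := by
  have h := hB.w3e (w) (1+v) (s+1+u) (s) (s+1+w) (-(s-v)) (u) (1) (1+w) (v) (s+u) (-(s+1))
    (by subst hw; refine ⟨?_, ?_, ?_, ?_, ?_, ?_, ?_, ?_⟩ <;> ring)
  simp only [hB.odd] at h
  simp only [hB.P2, hB.R2, wD1, wD2, wP1, wR1, show s + 1 - 1 = s by ring,
    show s + 1 + 1 = s + 2 by ring]
  linear_combination (norm := skip) (1/(B 1^2*B s^2)) * h
  field_simp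
  ring

lemma ybe_122_122 {B : ℂ → ℂ} (hB : IsTh B) {s u v w : ℂ} (hw : w = u + v)
    (h1 : B 1 ≠ 0) (hs : B s ≠ 0) (hs1 : B (s+1) ≠ 0) :
    wD2 B v * wR1 B s w * wD2 B u =
      wR1 B s v * wD2 B w * wR1 B s u + wP2 B s v * wR1 B (s+1) w * wP1 B s u := by
  have h := hB.w3e (s-w) (1-v) (1-u) (s) (s+1-w) (-(v)) (-(u)) (-(s-1)) (1-w) (s-v) (s-u) (-(1))
    (by subst hw; refine ⟨?_, ?_, ?_, ?_, ?_, ?_, ?_, ?_⟩ <;> ring)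
  simp only [hB.odd] at h
  simp only [hB.P2, hB.R2, wD1, wD2, wP1, wR1, show s + 1 - 1 = s by ring,
    show s + 1 + 1 = s + 2 by ring]
  linear_combination (norm := skip) (1/(B 1^2*B s^2)) * h
  field_simp
  ring

lemma ybe_122_212 {B : ℂ → ℂ} (hB : IsTh B) {s u v w : ℂ} (hw : w = u + v)
    (h1 : B 1 ≠ 0) (hs : B s ≠ 0) (hs1 : B (s+1) ≠ 0) :
    wR1 B (s+1) v * wP2 B s w * wD2 B u =
      wR1 B s v * wD2 B w * wP2 B s u + wP2 B s v * wR1 B (s+1) w * wR2 B s u := by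
  have h := hB.w3e (w) (s+1-v) (1-u) (s) (s+1) (u) (-(s-v)) (1-w) (1) (s+u) (v) (-(s+1-w))
    (by subst hw; refine ⟨?_, ?_, ?_, ?_, ?_, ?_, ?_, ?_⟩ <;> ring)
  simp only [hB.odd] at h
  simp only [hB.P2, hB.R2, wD1, wD2, wP1, wR1, show s + 1 - 1 = s by ring,
    show s + 1 + 1 = s + 2 by ring]
  linear_combination (norm := skip) (1/(B 1^2*B s^2)) * h
  field_simp
  ring

lemma ybe_122_221 {B : ℂ → ℂ} (hB : IsTh B) {s u v w : ℂ} (hw : w = u + v)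
    (h1 : B 1 ≠ 0) (hs : B s ≠ 0) (hs1 : B (s+1) ≠ 0) :
    wP2 B (s+1) v * wP2 B s w * wD2 B u =
      wP2 B s v * wP2 B (s+1) w * wD2 B u := by
  simp only [hB.P2, hB.R2, wD1, wD2, wP1, wR1, show s + 1 - 1 = s by ring,
    show s + 1 + 1 = s + 2 by ring]
  ring

lemma ybe_211_112 {B : ℂ → ℂ} (hB : IsTh B) {s u v w : ℂ} (hw : w = u + v)
    (h1 : B 1 ≠ 0) (hs : B s ≠ 0) (hs1 : B (s+1) ≠ 0) :
    wP1 B (s+1) v * wP1 B s w * wD1 B u =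
      wP1 B s v * wP1 B (s+1) w * wD1 B u := by
  simp only [hB.P2, hB.R2, wD1, wD2, wP1, wR1, show s + 1 - 1 = s by ring,
    show s + 1 + 1 = s + 2 by ring]
  ring

lemma ybe_211_121 {B : ℂ → ℂ} (hB : IsTh B) {s u v w : ℂ} (hw : w = u + v)
    (h1 : B 1 ≠ 0) (hs : B s ≠ 0) (hs1 : B (s+1) ≠ 0) :
    wR2 B (s+1) v * wP1 B s w * wD1 B u =
      wP1 B s v * wR2 B (s+1) w * wR1 B s u + wR2 B s v * wD1 B w * wP1 B s u := by
  have h := hB.w3e (w) (s+1+v) (1+u) (s) (s+1+w) (v) (-(s-u)) (1) (1+w) (s+v) (u) (-(s+1))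
    (by subst hw; refine ⟨?_, ?_, ?_, ?_, ?_, ?_, ?_, ?_⟩ <;> ring)
  simp only [hB.odd] at h
  simp only [hB.P2, hB.R2, wD1, wD2, wP1, wR1, show s + 1 - 1 = s by ring,
    show s + 1 + 1 = s + 2 by ring]
  linear_combination (norm := skip) (B (s-1)/(B 1^2*B s^2*B (s+1))) * h
  field_simp
  ring

lemma ybe_211_211 {B : ℂ → ℂ} (hB : IsTh B) {s u v w : ℂ} (hw : w = u + v)
    (h1 : B 1 ≠ 0) (hs : B s ≠ 0) (hs1 : B (s+1) ≠ 0) :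
    wD1 B v * wR2 B s w * wD1 B u =
      wP1 B s v * wR2 B (s+1) w * wP2 B s u + wR2 B s v * wD1 B w * wR2 B s u := by
  have h := hB.w3e (s+w) (1+v) (1+u) (s) (s+1+w) (v) (u) (-(s-1)) (1+w) (s+v) (s+u) (-(1))
    (by subst hw; refine ⟨?_, ?_, ?_, ?_, ?_, ?_, ?_, ?_⟩ <;> ring)
  simp only [hB.odd] at h
  simp only [hB.P2, hB.R2, wD1, wD2, wP1, wR1, show s + 1 - 1 = s by ring,
    show s + 1 + 1 = s + 2 by ring]
  linear_combination (norm := skip) (1/(B 1^2*B s^2)) * h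
  field_simp
  ring

lemma ybe_212_122 {B : ℂ → ℂ} (hB : IsTh B) {s u v w : ℂ} (hw : w = u + v)
    (h1 : B 1 ≠ 0) (hs : B s ≠ 0) (hs1 : B (s+1) ≠ 0) :
    wD2 B v * wP1 B s w * wR1 B (s+1) u =
      wP1 B s v * wD2 B w * wR1 B s u + wR2 B s v * wR1 B (s+1) w * wP1 B s u := by
  have h := hB.w3e (w) (1-v) (s+1-u) (s) (s+1) (-(s-u)) (v) (1-w) (1) (u) (s+v) (-(s+1-w))
    (by subst hw; refine ⟨?_, ?_, ?_, ?_, ?_, ?_, ?_, ?_⟩ <;> ring)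
  simp only [hB.odd] at h
  simp only [hB.P2, hB.R2, wD1, wD2, wP1, wR1, show s + 1 - 1 = s by ring,
    show s + 1 + 1 = s + 2 by ring]
  linear_combination (norm := skip) (B (s-1)/(B 1^2*B s^2*B (s+1))) * h
  field_simp
  ring

lemma ybe_212_212 {B : ℂ → ℂ} (hB : IsTh B) {s u v w : ℂ} (hw : w = u + v)
    (h1 : B 1 ≠ 0) (hs : B s ≠ 0) (hs1 : B (s+1) ≠ 0) :
    wR1 B (s+1) v * wR2 B s w * wR1 B (s+1) u + wP1 B (s+1) v * wD2 B w * wP2 B (s+1) u =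
      wP1 B s v * wD2 B w * wP2 B s u + wR2 B s v * wR1 B (s+1) w * wR2 B s u := by
  have h := hB.w3e (s+v) (s+u) (s+1-w) (s+1) (2*s+1) (-(1-w)) (-(u)) (-(v)) (s) (s+w) (s+1-u) (-(s+1-v))
    (by subst hw; refine ⟨?_, ?_, ?_, ?_, ?_, ?_, ?_, ?_⟩ <;> ring)
  simp only [hB.odd] at h
  have h3 := hB.w3e (s+2) (s) (s) (s) (2*s+1) (1) (1) (-(1)) (s+1) (s+1) (s+1) (-(s-1))
    (by subst hw; refine ⟨?_, ?_, ?_, ?_, ?_, ?_, ?_, ?_⟩ <;> ring)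
  simp only [hB.odd] at h3
  simp only [hB.P2, hB.R2, wD1, wD2, wP1, wR1, show s + 1 - 1 = s by ring,
    show s + 1 + 1 = s + 2 by ring]
  linear_combination (norm := skip) (B (1-w)*B v*B u/(B 1^3*B s^2*B (s+1)^2)) * h3 - (1/(B s^2*B (s+1)^2)) * h
  field_simp
  ring

lemma ybe_212_221 {B : ℂ → ℂ} (hB : IsTh B) {s u v w : ℂ} (hw : w = u + v)
    (h1 : B 1 ≠ 0) (hs : B s ≠ 0) (hs1 : B (s+1) ≠ 0) :
    wP2 B (s+1) v * wR2 B s w * wR1 B (s+1) u + wR2 B (s+1) v * wD2 B w * wP2 B (s+1) u =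
      wR2 B s v * wP2 B (s+1) w * wD2 B u := by
  have h := hB.w3e (1-w) (s+1+v) (u) (s) (s+1) (1-u) (-(s+v)) (w) (1) (s+1-u) (-(v)) (-(s+w))
    (by subst hw; refine ⟨?_, ?_, ?_, ?_, ?_, ?_, ?_, ?_⟩ <;> ring)
  simp only [hB.odd] at h
  simp only [hB.P2, hB.R2, wD1, wD2, wP1, wR1, show s + 1 - 1 = s by ring,
    show s + 1 + 1 = s + 2 by ring]
  linear_combination (norm := skip) (B (s+2)/(B 1^2*B (s+1)^2*B s)) * h
  field_simp
  ring

lemma ybe_221_122 {B : ℂ → ℂ} (hB : IsTh B) {s u v w : ℂ} (hw : w = u + v)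
    (h1 : B 1 ≠ 0) (hs : B s ≠ 0) (hs1 : B (s+1) ≠ 0) :
    wD2 B v * wP1 B s w * wP1 B (s+1) u =
      wD2 B v * wP1 B (s+1) w * wP1 B s u := by
  simp only [hB.P2, hB.R2, wD1, wD2, wP1, wR1, show s + 1 - 1 = s by ring,
    show s + 1 + 1 = s + 2 by ring]
  ring

lemma ybe_221_212 {B : ℂ → ℂ} (hB : IsTh B) {s u v w : ℂ} (hw : w = u + v)
    (h1 : B 1 ≠ 0) (hs : B s ≠ 0) (hs1 : B (s+1) ≠ 0) :
    wR1 B (s+1) v * wR2 B s w * wP1 B (s+1) u + wP1 B (s+1) v * wD2 B w * wR2 B (s+1) u =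
      wD2 B v * wP1 B (s+1) w * wR2 B s u := by
  have h := hB.w3e (1-w) (v) (s+1+u) (s) (s+1) (-(s+u)) (1-v) (w) (1) (-(u)) (s+1-v) (-(s+w))
    (by subst hw; refine ⟨?_, ?_, ?_, ?_, ?_, ?_, ?_, ?_⟩ <;> ring)
  simp only [hB.odd] at h
  simp only [hB.P2, hB.R2, wD1, wD2, wP1, wR1, show s + 1 - 1 = s by ring,
    show s + 1 + 1 = s + 2 by ring]
  linear_combination (norm := skip) (1/(B 1^2*B (s+1)^2)) * h
  field_simp
  ring

lemma ybe_221_221 {B : ℂ → ℂ} (hB : IsTh B) {s u v w : ℂ} (hw : w = u + v)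
    (h1 : B 1 ≠ 0) (hs : B s ≠ 0) (hs1 : B (s+1) ≠ 0) :
    wP2 B (s+1) v * wR2 B s w * wP1 B (s+1) u + wR2 B (s+1) v * wD2 B w * wR2 B (s+1) u =
      wD2 B v * wR2 B (s+1) w * wD2 B u := by
  have h := hB.w3e (1-w) (s+1+v) (s+1+u) (1) (s+2) (-(u)) (-(v)) (s+w) (s+1) (1-u) (1-v) (-(s+1+w))
    (by subst hw; refine ⟨?_, ?_, ?_, ?_, ?_, ?_, ?_, ?_⟩ <;> ring)
  simp only [hB.odd] at h
  simp only [hB.P2, hB.R2, wD1, wD2, wP1, wR1, show s + 1 - 1 = s by ring,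
    show s + 1 + 1 = s + 2 by ring]
  linear_combination (norm := skip) (1/(B 1^2*B (s+1)^2)) * h
  field_simp
  ring


lemma aSc_shift (ω : ℂ) (e p : ℤ × ℤ) : aSc ω (e + p) = aSc (ω + e.1 + e.2) p := by
  simp only [aSc, Prod.fst_add, Prod.snd_add]; push_cast; ring

lemma faceW_shift (q : ℝ) (lam ω : ℂ) (e a b c d : ℤ × ℤ) (u v : ℂ) :
    faceW q lam ω (e + a) (e + b) (e + c) (e + d) u v =
      faceW q lam (ω + e.1 + e.2) a b c d u v := by
  simp only [faceW, aSc_shift, add_assoc, add_right_inj]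

lemma faceW_eq (q : ℝ) (lam ω : ℂ) (a b c d : ℤ × ℤ) (u v : ℂ) :
    faceW q lam ω a b c d u v =
  if b = a + e1 ∧ c = a + e1 ∧ d = a + e1 + e1 then wD1 (brak q lam) (u - v)
  else if b = a + e2 ∧ c = a + e2 ∧ d = a + e2 + e2 then wD2 (brak q lam) (u - v)
  else if b = a + e2 ∧ c = a + e1 ∧ d = a + e1 + e2 then wP1 (brak q lam) (aSc ω a) (u - v)
  else if b = a + e1 ∧ c = a + e2 ∧ d = a + e1 + e2 then wP2 (brak q lam) (aSc ω a) (u - v)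
  else if b = a + e1 ∧ c = a + e1 ∧ d = a + e1 + e2 then wR1 (brak q lam) (aSc ω a) (u - v)
  else if b = a + e2 ∧ c = a + e2 ∧ d = a + e1 + e2 then wR2 (brak q lam) (aSc ω a) (u - v)
  else 0 := rfl

lemma faceW_supp {q : ℝ} {lam ω : ℂ} {a b c d : ℤ × ℤ} {u v : ℂ}
    (h : faceW q lam ω a b c d u v ≠ 0) :
    (b = a + e1 ∨ b = a + e2) ∧ (c = a + e1 ∨ c = a + e2) ∧
    (d = b + e1 ∨ d = b + e2) ∧ (d = c + e1 ∨ d = c + e2) := by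
  rw [faceW_eq] at h
  have hc : a + e1 + e2 = a + e2 + e1 := by abel
  split_ifs at h with h1 h2 h3 h4 h5 h6
  · obtain ⟨rfl, rfl, rfl⟩ := h1; simp
  · obtain ⟨rfl, rfl, rfl⟩ := h2; simp
  · obtain ⟨rfl, rfl, rfl⟩ := h3; simp [hc]
  · obtain ⟨rfl, rfl, rfl⟩ := h4; simp [hc]
  · obtain ⟨rfl, rfl, rfl⟩ := h5; simp
  · obtain ⟨rfl, rfl, rfl⟩ := h6; simp [hc]
  · exact absurd rfl h

lemma e1_ne_e2 : e1 ≠ e2 := by simp [e1, e2]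

set_option maxHeartbeats 4000000 in
/-- The two-term form of the star-triangle relation, based at the origin. -/
lemma ybe_origin (q : ℝ) (lam ω : ℂ) (hB : IsTh (brak q lam)) (hbr1 : brak q lam 1 ≠ 0)
    (hbrA : ∀ b : ℤ × ℤ, brak q lam (aSc ω b) ≠ 0)
    (a b c d f : ℤ × ℤ) (u1 u2 u3 : ℂ)
    (hd : d = e1 ∨ d = e2) (hf : f = e1 ∨ f = e2) (hc : c = d + e1 ∨ c = d + e2)
    (ha : a = f + e1 ∨ a = f + e2) (hb : b = c + e1 ∨ b = c + e2) :
    faceW q lam ω f (f + e1) a b u1 u3 * faceW q lam ω 0 d f (f + e1) u2 u3 *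
        faceW q lam ω d c (f + e1) b u2 u1 +
      faceW q lam ω f (f + e2) a b u1 u3 * faceW q lam ω 0 d f (f + e2) u2 u3 *
        faceW q lam ω d c (f + e2) b u2 u1 =
    faceW q lam ω 0 d e1 c u1 u3 * faceW q lam ω e1 c a b u2 u3 *
        faceW q lam ω 0 e1 f a u2 u1 +
      faceW q lam ω 0 d e2 c u1 u3 * faceW q lam ω e2 c a b u2 u3 *
        faceW q lam ω 0 e2 f a u2 u1 := by
  have hs : brak q lam ω ≠ 0 := by simpa [aSc] using hbrA 0
  have hs1 : brak q lam (ω + 1) ≠ 0 := by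
    have := hbrA e1
    simpa [aSc, e1, add_comm] using this
  have s0 : aSc ω (0, 0) = ω := by simp [aSc]
  have s0' : aSc ω 0 = ω := by simp [aSc]
  have s1 : aSc ω (1, 0) = ω + 1 := by simp [aSc, add_comm]
  have s2 : aSc ω (0, 1) = ω + 1 := by simp [aSc, add_comm]
  have hw : u2 - u3 = (u2 - u1) + (u1 - u3) := by ring
  have z0 : (0 : ℤ × ℤ) = (0, 0) := rfl
  rcases hd with rfl | rfl <;> rcases hf with rfl | rfl <;> rcases hc with rfl | rfl <;>
    rcases ha with rfl | rfl <;> rcases hb with rfl | rfl <;>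
    norm_num [faceW_eq, e1, e2, z0, s0, s0', s1, s2, -mul_eq_mul_left_iff, -mul_eq_mul_right_iff]
  all_goals first
    | rfl
    | linear_combination ybe_112_112 hB hw hbr1 hs hs1
    | linear_combination ybe_112_121 hB hw hbr1 hs hs1
    | linear_combination ybe_112_211 hB hw hbr1 hs hs1
    | linear_combination ybe_121_112 hB hw hbr1 hs hs1
    | linear_combination ybe_121_121 hB hw hbr1 hs hs1
    | linear_combination ybe_121_211 hB hw hbr1 hs hs1
    | linear_combination ybe_122_122 hB hw hbr1 hs hs1
    | linear_combination ybe_122_212 hB hw hbr1 hs hs1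
    | linear_combination ybe_122_221 hB hw hbr1 hs hs1
    | linear_combination ybe_211_112 hB hw hbr1 hs hs1
    | linear_combination ybe_211_121 hB hw hbr1 hs hs1
    | linear_combination ybe_211_211 hB hw hbr1 hs hs1
    | linear_combination ybe_212_122 hB hw hbr1 hs hs1
    | linear_combination ybe_212_212 hB hw hbr1 hs hs1
    | linear_combination ybe_212_221 hB hw hbr1 hs hs1
    | linear_combination ybe_221_122 hB hw hbr1 hs hs1
    | linear_combination ybe_221_212 hB hw hbr1 hs hs1
    | linear_combination ybe_221_221 hB hw hbr1 hs hs1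



/-- The star-triangle relation for an abstract theta-like bracket. -/
lemma ybe_of_isTh (q : ℝ) (lam : ℂ) (ω12 : ℂ) (hB : IsTh (brak q lam))
    (hbr1 : brak q lam 1 ≠ 0)
    (hbrA : ∀ b : ℤ × ℤ, brak q lam (aSc ω12 b) ≠ 0)
    (a b c d e f : ℤ × ℤ) (u1 u2 u3 : ℂ) :
    {g : ℤ × ℤ | faceW q lam ω12 f g a b u1 u3 * faceW q lam ω12 e d f g u2 u3 *
        faceW q lam ω12 d c g b u2 u1 ≠ 0}.Finite ∧
    {g : ℤ × ℤ | faceW q lam ω12 e d g c u1 u3 * faceW q lam ω12 g c a b u2 u3 *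
        faceW q lam ω12 e g f a u2 u1 ≠ 0}.Finite ∧
    ∑' g : ℤ × ℤ, faceW q lam ω12 f g a b u1 u3 * faceW q lam ω12 e d f g u2 u3 *
        faceW q lam ω12 d c g b u2 u1 =
      ∑' g : ℤ × ℤ, faceW q lam ω12 e d g c u1 u3 * faceW q lam ω12 g c a b u2 u3 *
        faceW q lam ω12 e g f a u2 u1 := by
  have HL : ∀ g, faceW q lam ω12 f g a b u1 u3 * faceW q lam ω12 e d f g u2 u3 *
        faceW q lam ω12 d c g b u2 u1 ≠ 0 → (d = e + e1 ∨ d = e + e2) ∧ (f = e + e1 ∨ f = e + e2) ∧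
        (c = d + e1 ∨ c = d + e2) ∧ (a = f + e1 ∨ a = f + e2) ∧ (b = c + e1 ∨ b = c + e2) ∧
        g ∈ ({f + e1, f + e2} : Finset (ℤ × ℤ)) := by
    intro g hg
    have h12 := left_ne_zero_of_mul hg
    have h3 := faceW_supp (right_ne_zero_of_mul hg)
    have h1 := faceW_supp (left_ne_zero_of_mul h12)
    have h2 := faceW_supp (right_ne_zero_of_mul h12)
    exact ⟨h2.1, h2.2.1, h3.1, h1.2.1, h3.2.2.1, by simpa using h1.1⟩
  have HR : ∀ g, faceW q lam ω12 e d g c u1 u3 * faceW q lam ω12 g c a b u2 u3 *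
        faceW q lam ω12 e g f a u2 u1 ≠ 0 → (d = e + e1 ∨ d = e + e2) ∧ (f = e + e1 ∨ f = e + e2) ∧
        (c = d + e1 ∨ c = d + e2) ∧ (a = f + e1 ∨ a = f + e2) ∧ (b = c + e1 ∨ b = c + e2) ∧
        g ∈ ({e + e1, e + e2} : Finset (ℤ × ℤ)) := by
    intro g hg
    have h12 := left_ne_zero_of_mul hg
    have h3 := faceW_supp (right_ne_zero_of_mul hg)
    have h1 := faceW_supp (left_ne_zero_of_mul h12)
    have h2 := faceW_supp (right_ne_zero_of_mul h12)
    exact ⟨h1.1, h3.2.1, h1.2.2.1, h3.2.2.2, h2.2.2.1, by simpa using h1.2.1⟩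
  refine ⟨(Finset.finite_toSet {f + e1, f + e2}).subset fun g hg => (HL g hg).2.2.2.2.2,
    (Finset.finite_toSet {e + e1, e + e2}).subset fun g hg => (HR g hg).2.2.2.2.2, ?_⟩
  by_cases hall : (d = e + e1 ∨ d = e + e2) ∧ (f = e + e1 ∨ f = e + e2) ∧
        (c = d + e1 ∨ c = d + e2) ∧ (a = f + e1 ∨ a = f + e2) ∧ (b = c + e1 ∨ b = c + e2)
  · rw [tsum_eq_sum (s := {f + e1, f + e2}), tsum_eq_sum (s := {e + e1, e + e2}),
      Finset.sum_pair (by simpa using e1_ne_e2), Finset.sum_pair (by simpa using e1_ne_e2)]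
    · obtain ⟨a, rfl⟩ : ∃ a', a = e + a' := ⟨a - e, by abel⟩
      obtain ⟨b, rfl⟩ : ∃ a', b = e + a' := ⟨b - e, by abel⟩
      obtain ⟨c, rfl⟩ : ∃ a', c = e + a' := ⟨c - e, by abel⟩
      obtain ⟨d, rfl⟩ : ∃ a', d = e + a' := ⟨d - e, by abel⟩
      obtain ⟨f, rfl⟩ : ∃ a', f = e + a' := ⟨f - e, by abel⟩
      simp only [add_assoc, add_right_inj] at hall
      obtain ⟨hd, hf, hc, ha, hb⟩ := hall
      have key := ybe_origin q lam (ω12 + e.1 + e.2) hB hbr1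
        (fun b => by rw [← aSc_shift]; exact hbrA _) a b c d f u1 u2 u3 hd hf hc ha hb
      simp only [← faceW_shift, add_zero, ← add_assoc] at key
      exact key
    · intro g hg; by_contra h; exact hg (HR g h).2.2.2.2.2
    · intro g hg; by_contra h; exact hg (HL g h).2.2.2.2.2
  · have hl : ∀ g, faceW q lam ω12 f g a b u1 u3 * faceW q lam ω12 e d f g u2 u3 *
        faceW q lam ω12 d c g b u2 u1 = 0 := fun g => by
      by_contra h; obtain ⟨h1, h2, h3, h4, h5, -⟩ := HL g h; exact hall ⟨h1, h2, h3, h4, h5⟩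
    have hr : ∀ g, faceW q lam ω12 e d g c u1 u3 * faceW q lam ω12 g c a b u2 u3 *
        faceW q lam ω12 e g f a u2 u1 = 0 := fun g => by
      by_contra h; obtain ⟨h1, h2, h3, h4, h5, -⟩ := HR g h; exact hall ⟨h1, h2, h3, h4, h5⟩
    simp only [hl, hr]


lemma summable_gauss (a b : ℂ) (ha : a.re < 0) :
    Summable fun n : ℤ => cexp (a * n ^ 2 + b * n) := by
  have hpi : (Real.pi : ℂ) ≠ 0 := by exact_mod_cast Real.pi_ne_zero
  have h : 0 < (a / (Real.pi * I)).im := by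
    have : a / (Real.pi * I) = ((1 / Real.pi : ℝ) : ℂ) * (-(I * a)) := by
      push_cast
      field_simp
      rw [I_sq]; ring
    rw [this, Complex.im_ofReal_mul]
    have h1 : (-(I * a)).im = -a.re := by simp
    rw [h1]
    exact mul_pos (by positivity) (by linarith)
  have := (summable_jacobiTheta₂_term_iff (b / (2 * Real.pi * I)) (a / (Real.pi * I))).2 h
  refine this.congr fun n => ?_
  unfold jacobiTheta₂_term
  congr 1
  field_simp
  ring

/-- The theta series. -/
def thT (L J x : ℂ) (i : ℤ) : ℂ := (-1) ^ i * cexp (L * (i ^ 2 - i) + (2 * i - 1) * J * x)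
def thE (L J x : ℂ) (k : ℤ) : ℂ := cexp (L * (2 * k ^ 2) + 4 * k * J * x)
def thO (L J x : ℂ) (k : ℤ) : ℂ := cexp (L * (2 * k ^ 2 + 2 * k) + 2 * (2 * k + 1) * J * x)

lemma summable_thT (L J x : ℂ) (hL : L.re < 0) : Summable (thT L J x) := by
  rw [← summable_norm_iff]
  have := ((summable_gauss L (2 * J * x - L) hL).norm).mul_left ‖cexp (-(J * x))‖
  refine this.congr fun i => ?_
  rw [← norm_mul, ← Complex.exp_add, thT, norm_mul, norm_zpow, norm_neg, norm_one, one_zpow,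
    one_mul]
  congr 2; ring

lemma summable_thE (L J x : ℂ) (hL : L.re < 0) : Summable (thE L J x) := by
  refine (summable_gauss (2 * L) (4 * J * x) (by simp; linarith)).congr fun i => ?_
  rw [thE]; congr 1; ring

lemma summable_thO (L J x : ℂ) (hL : L.re < 0) : Summable (thO L J x) := by
  refine ((summable_gauss (2 * L) (4 * J * x + 2 * L) (by simp; linarith)).mul_left
    (cexp (2 * J * x))).congr fun i => ?_
  rw [thO, ← Complex.exp_add]; congr 1; ring

/-- Splitting `ℤ × ℤ` according to the parity of the sum of the coordinates. -/
def parEquiv : (ℤ × ℤ) ⊕ (ℤ × ℤ) ≃ ℤ × ℤ where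
  toFun := Sum.elim (fun p => (p.1 + p.2 + 1, p.1 - p.2)) (fun p => (p.1 + p.2 + 1, p.1 - p.2 + 1))
  invFun m := if (m.1 + m.2) % 2 = 1 then Sum.inl ((m.1 + m.2 - 1) / 2, (m.1 - m.2 - 1) / 2)
    else Sum.inr ((m.1 + m.2 - 2) / 2, (m.1 - m.2) / 2)
  left_inv := by
    rintro (⟨k, l⟩ | ⟨k, l⟩)
    · have h : (k + l + 1 + (k - l)) % 2 = 1 := by omega
      simp only [Sum.elim_inl, h, if_true]
      congr 2 <;> omega
    · have h : ¬ (k + l + 1 + (k - l + 1)) % 2 = 1 := by omega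
      simp only [Sum.elim_inr, h, if_false]
      congr 2 <;> omega
  right_inv := by
    rintro ⟨m, n⟩
    by_cases h : (m + n) % 2 = 1
    · simp only [h, if_true, Sum.elim_inl, Prod.mk.injEq]
      constructor <;> omega
    · simp only [h, if_false, Sum.elim_inr, Prod.mk.injEq]
      constructor <;> omega

lemma thT_addition (L J x y : ℂ) (hL : L.re < 0) :
    (∑' i, thT L J (x + y) i) * (∑' i, thT L J (x - y) i) =
      (∑' i, thO L J x i) * (∑' i, thE L J y i) - (∑' i, thE L J x i) * (∑' i, thO L J y i) := by
  have hp := (summable_thT L J (x + y) hL).norm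
  have hm := (summable_thT L J (x - y) hL).norm
  have h1 := (summable_thE L J x hL).norm
  have h2 := (summable_thE L J y hL).norm
  have h3 := (summable_thO L J x hL).norm
  have h4 := (summable_thO L J y hL).norm
  have hs := (summable_mul_of_summable_norm hp hm)
  rw [tsum_mul_tsum_of_summable_norm hp hm, tsum_mul_tsum_of_summable_norm h3 h2,
    tsum_mul_tsum_of_summable_norm h1 h4, ← parEquiv.tsum_eq]
  have hs' := parEquiv.summable_iff.2 hs
  rw [Summable.tsum_sum (f := fun p => thT L J (x + y) (parEquiv p).1 * thT L J (x - y) (parEquiv p).2)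
    (hs'.comp_injective Sum.inl_injective) (hs'.comp_injective Sum.inr_injective)]
  have e1 : ∀ p : ℤ × ℤ, thT L J (x + y) (parEquiv (Sum.inl p)).1 *
      thT L J (x - y) (parEquiv (Sum.inl p)).2 = - (thE L J x p.1 * thO L J y p.2) := by
    rintro ⟨k, l⟩
    simp only [parEquiv, Equiv.coe_fn_mk, Sum.elim_inl, thT, thE, thO]
    rw [← Complex.exp_add, mul_mul_mul_comm, ← Complex.exp_add, ← zpow_add₀ (by norm_num),
      show k + l + 1 + (k - l) = 2 * k + 1 by ring, zpow_add₀ (by norm_num), zpow_mul]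
    norm_num
    congr 1; push_cast; ring
  have e2 : ∀ p : ℤ × ℤ, thT L J (x + y) (parEquiv (Sum.inr p)).1 *
      thT L J (x - y) (parEquiv (Sum.inr p)).2 = thO L J x p.1 * thE L J y p.2 := by
    rintro ⟨k, l⟩
    simp only [parEquiv, Equiv.coe_fn_mk, Sum.elim_inr, thT, thE, thO]
    rw [← Complex.exp_add, mul_mul_mul_comm, ← Complex.exp_add, ← zpow_add₀ (by norm_num),
      show k + l + 1 + (k - l + 1) = 2 * (k + 1) by ring, zpow_mul]
    norm_num
    congr 1; push_cast; ring
  simp only [e1, e2, tsum_neg]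
  ring

/-- Gaussian binomial coefficients in base `q ^ 2`. -/
def qG (q : ℝ) : ℕ → ℕ → ℝ
  | _, 0 => 1
  | 0, _ + 1 => 0
  | N + 1, j + 1 => qG q N j + q ^ (2 * (j + 1)) * qG q N (j + 1)

def qp (q : ℝ) (n : ℕ) : ℝ := ∏ k ∈ Finset.range n, (1 - q ^ (2 * k + 2))

lemma qG_zero_right (q : ℝ) (N : ℕ) : qG q N 0 = 1 := by cases N <;> rfl

lemma qG_eq_zero (q : ℝ) : ∀ N j, N < j → qG q N j = 0
  | _, 0, h => absurd h (Nat.not_lt_zero _)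
  | 0, _ + 1, _ => rfl
  | N + 1, j + 1, h => by
    rw [qG, qG_eq_zero q N j (by omega), qG_eq_zero q N (j + 1) (by omega)]; simp

lemma qG_mul (q : ℝ) : ∀ N j k, N = j + k → qG q N j * (qp q j * qp q k) = qp q N
  | N, 0, k, h => by simp [qG_zero_right, qp, h]
  | 0, j + 1, k, h => by omega
  | N + 1, j + 1, 0, h => by
    have h1 := qG_mul q N j 0 (by omega)
    rw [qG, qG_eq_zero q N (j + 1) (by omega)]
    have : N = j := by omega
    subst this
    have a : qp q (N + 1) = qp q N * (1 - q ^ (2 * N + 2)) := by simp [qp, Finset.prod_range_succ]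
    rw [a]
    linear_combination (1 - q ^ (2 * N + 2)) * h1
  | N + 1, j + 1, k + 1, h => by
    have h1 := qG_mul q N j (k + 1) (by omega)
    have h2 := qG_mul q N (j + 1) k (by omega)
    have hN : N = j + k + 1 := by omega
    have a : ∀ m, qp q (m + 1) = qp q m * (1 - q ^ (2 * m + 2)) := fun m => by
      simp [qp, Finset.prod_range_succ]
    rw [qG, a N]
    rw [a j] at h2 ⊢
    rw [a k] at h1 ⊢
    subst hN
    linear_combination (1 - q ^ (2 * j + 2)) * h1 + q ^ (2 * j + 2) * (1 - q ^ (2 * k + 2)) * h2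

lemma qbinom (q : ℝ) (N : ℕ) (Y : ℂ) :
    ∏ k ∈ Finset.range N, (1 + (q : ℂ) ^ (2 * k + 1) * Y) =
      ∑ j ∈ Finset.range (N + 1), (q : ℂ) ^ (j ^ 2) * (qG q N j : ℂ) * Y ^ j := by
  induction N generalizing Y with
  | zero => simp [qG]
  | succ N ih =>
    rw [Finset.prod_range_succ']
    have : ∏ k ∈ Finset.range N, (1 + (q : ℂ) ^ (2 * (k + 1) + 1) * Y) =
        ∏ k ∈ Finset.range N, (1 + (q : ℂ) ^ (2 * k + 1) * (q ^ 2 * Y)) :=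
      Finset.prod_congr rfl fun k _ => by ring
    rw [this, ih, Finset.sum_range_succ' _ (N + 1)]
    have h0 : ∀ j, (q : ℂ) ^ ((j + 1) ^ 2) * (qG q (N + 1) (j + 1) : ℂ) * Y ^ (j + 1) =
        (q : ℂ) ^ (j ^ 2) * (qG q N j : ℂ) * (q ^ 2 * Y) ^ j * (q * Y) +
        (q : ℂ) ^ ((j + 1) ^ 2) * (qG q N (j + 1) : ℂ) * (q ^ 2 * Y) ^ (j + 1) := fun j => by
      rw [qG]; push_cast; ring
    simp only [h0, Finset.sum_add_distrib, ← Finset.sum_mul]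
    have h1 := Finset.sum_range_succ' (fun j => (q : ℂ) ^ (j ^ 2) * (qG q N j : ℂ) * (q ^ 2 * Y) ^ j)
      (N + 1)
    rw [Finset.sum_range_succ _ (N + 1), qG_eq_zero q N (N + 1) (by omega)] at h1
    simp only [qG_zero_right] at h1 ⊢
    push_cast at h1 ⊢
    simp only [mul_zero, zero_mul, add_zero] at h1
    linear_combination h1

lemma qp_pos {q : ℝ} (h0 : 0 < q) (h1 : q < 1) (n : ℕ) : 0 < qp q n :=
  Finset.prod_pos fun k _ => by
    have := pow_lt_one₀ h0.le h1 (show 2 * k + 2 ≠ 0 by omega)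
    linarith

lemma summable_qpow {q : ℝ} (h0 : 0 < q) (h1 : q < 1) : Summable fun n : ℕ => q ^ (2 * n + 2) := by
  have : Summable fun n : ℕ => q ^ 2 * (q ^ 2) ^ n :=
    (summable_geometric_of_lt_one (by positivity) (pow_lt_one₀ h0.le h1 (by norm_num))).mul_left _
  exact this.congr fun n => by ring

lemma qp_lim {q : ℝ} (h0 : 0 < q) (h1 : q < 1) :
    ∃ P : ℝ, 0 < P ∧ (∀ n, P ≤ qp q n) ∧ Filter.Tendsto (qp q) Filter.atTop (nhds P) := by
  have hs : Summable fun n : ℕ => ‖-(q ^ (2 * n + 2))‖ := by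
    simp only [norm_neg]; exact (summable_qpow h0 h1).norm
  have hm := multipliable_one_add_of_summable hs
  have hne := tprod_one_add_ne_zero_of_summable (f := fun n : ℕ => -(q ^ (2 * n + 2)))
    (fun n => by
      have := pow_lt_one₀ h0.le h1 (show 2 * n + 2 ≠ 0 by omega)
      linarith) hs
  have ht := hm.hasProd.tendsto_prod_nat
  have ht' : Filter.Tendsto (qp q) Filter.atTop (nhds (∏' n : ℕ, (1 + -(q ^ (2 * n + 2))))) := by
    refine ht.congr fun n => ?_
    simp [qp, sub_eq_add_neg]
  have ha : Antitone (qp q) := antitone_nat_of_succ_le fun n => by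
    have a : qp q (n + 1) = qp q n * (1 - q ^ (2 * n + 2)) := by
      simp [qp, Finset.prod_range_succ]
    rw [a]
    have := qp_pos h0 h1 n
    have : 0 < q ^ (2 * n + 2) := by positivity
    nlinarith
  have hle := fun n => ha.le_of_tendsto ht' n
  refine ⟨_, lt_of_le_of_ne ?_ hne.symm, hle, ht'⟩
  exact ge_of_tendsto' ht' fun n => (qp_pos h0 h1 n).le

/-- The coefficient of the finite triple product. -/
def qc (q : ℝ) (n : ℕ) (i : ℤ) : ℝ := if 0 ≤ (n : ℤ) + i then qG q (2 * n + 1) ((n : ℤ) + i).toNat else 0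

lemma toNat_tendsto (i : ℤ) :
    Filter.Tendsto (fun n : ℕ => ((n : ℤ) + i).toNat) Filter.atTop Filter.atTop := by
  refine Filter.tendsto_atTop.2 fun b => ?_
  filter_upwards [Filter.eventually_ge_atTop (b + i.natAbs)] with n hn
  omega

lemma qc_bound {q : ℝ} (h0 : 0 < q) (h1 : q < 1) {P : ℝ} (hP : 0 < P) (hle : ∀ n, P ≤ qp q n)
    (n : ℕ) (i : ℤ) : |qc q n i| ≤ 1 / P ^ 2 := by
  have hpos : 0 ≤ 1 / P ^ 2 := by positivity
  unfold qc
  split_ifs with h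
  · by_cases hj : 2 * n + 1 < ((n : ℤ) + i).toNat
    · rw [qG_eq_zero _ _ _ hj]; simpa using hpos
    · have := qG_mul q (2 * n + 1) ((n : ℤ) + i).toNat (2 * n + 1 - ((n : ℤ) + i).toNat) (by omega)
      have ha := qp_pos h0 h1 ((n : ℤ) + i).toNat
      have hb := qp_pos h0 h1 (2 * n + 1 - ((n : ℤ) + i).toNat)
      have hN : qp q (2 * n + 1) ≤ 1 := Finset.prod_le_one
        (fun k _ => by
          have := pow_lt_one₀ h0.le h1 (show 2 * k + 2 ≠ 0 by omega)
          linarith)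
        (fun k _ => by have : 0 < q ^ (2 * k + 2) := by positivity
                       linarith)
      rw [← eq_div_iff (by positivity)] at this
      rw [this, abs_of_nonneg (div_nonneg (qp_pos h0 h1 _).le (by positivity))]
      have := hle ((n : ℤ) + i).toNat
      have := hle (2 * n + 1 - ((n : ℤ) + i).toNat)
      rw [sq]
      gcongr
  · simpa using hpos

lemma qc_tendsto {q : ℝ} (h0 : 0 < q) (h1 : q < 1) {P : ℝ} (hP : 0 < P)
    (ht : Filter.Tendsto (qp q) Filter.atTop (nhds P)) (i : ℤ) :
    Filter.Tendsto (fun n => qc q n i) Filter.atTop (nhds (1 / P)) := by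
  have ta := ht.comp (toNat_tendsto i)
  have tb := ht.comp (toNat_tendsto (1 - i))
  have tc : Filter.Tendsto (fun n : ℕ => qp q (2 * n + 1)) Filter.atTop (nhds P) :=
    ht.comp (Filter.tendsto_atTop_mono (fun n => by simp only [id]; omega) Filter.tendsto_id)
  have := tc.div (ta.mul tb) (by positivity)
  rw [show P / (P * P) = 1 / P by field_simp] at this
  refine this.congr' ?_
  filter_upwards [Filter.eventually_ge_atTop (2 + i.natAbs)] with n hn
  have hg := qG_mul q (2 * n + 1) ((n : ℤ) + i).toNat ((n : ℤ) + (1 - i)).toNat (by omega)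
  have ha := qp_pos h0 h1 ((n : ℤ) + i).toNat
  have hb := qp_pos h0 h1 ((n : ℤ) + (1 - i)).toNat
  rw [qc, if_pos (by omega)]
  simp only [Pi.div_apply, Pi.mul_apply, Function.comp_apply]
  rw [div_eq_iff (by positivity), hg]

lemma refl_prod {q : ℝ} (h0 : 0 < q) (L w : ℂ) (hL : (q : ℂ) = cexp L) (n : ℕ) :
    (∏ k ∈ Finset.range n, (1 - (q : ℂ) ^ (2 * k + 1) * cexp (-(2 * n + 1) * L - w))) *
      ((-1) ^ n * cexp (L * (n ^ 2 + n) + n * w)) =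
    ∏ k ∈ Finset.range n, (1 - (q : ℂ) ^ (2 * k + 2) * cexp w) := by
  rw [← Finset.prod_range_reflect]
  have : ∀ k ∈ Finset.range n, (1 - (q : ℂ) ^ (2 * (n - 1 - k) + 1) * cexp (-(2 * n + 1) * L - w)) =
      (1 - cexp (-(2 * k + 2) * L - w)) := by
    intro k hk
    have hk := Finset.mem_range.1 hk
    obtain ⟨m, rfl⟩ : ∃ m, n = k + 1 + m := ⟨n - 1 - k, by omega⟩
    rw [show k + 1 + m - 1 - k = m by omega, hL, ← Complex.exp_nat_mul, ← Complex.exp_add]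
    congr 2; push_cast; ring
  rw [Finset.prod_congr rfl this]
  clear this
  induction n with
  | zero => simp
  | succ n ih =>
    rw [Finset.prod_range_succ, Finset.prod_range_succ, ← ih]
    have e1 : cexp (L * (((n + 1 : ℕ) : ℂ) ^ 2 + ((n + 1 : ℕ) : ℂ)) + ((n + 1 : ℕ) : ℂ) * w) =
        cexp (L * (n ^ 2 + n) + n * w) * cexp ((2 * n + 2) * L + w) := by
      rw [← Complex.exp_add]; congr 1; push_cast; ring
    have e2 : (q : ℂ) ^ (2 * n + 2) * cexp w = cexp ((2 * n + 2) * L + w) := by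
      rw [hL, ← Complex.exp_nat_mul, ← Complex.exp_add]; congr 1; push_cast; ring
    have e3 : cexp (-(2 * n + 2) * L - w) * cexp ((2 * n + 2) * L + w) = 1 := by
      rw [← Complex.exp_add, ← Complex.exp_zero]; congr 1; ring
    rw [e1, e2, pow_succ]
    linear_combination (∏ k ∈ Finset.range n, (1 - cexp (-(2 * k + 2) * L - w))) * (-1) ^ n *
      cexp (L * (n ^ 2 + n) + n * w) * e3

/-- Finite Jacobi triple product. -/
lemma finite_triple {q : ℝ} (h0 : 0 < q) (L w : ℂ) (hL : (q : ℂ) = cexp L) (n : ℕ) :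
    (1 - cexp (-w)) * ∏ k ∈ Finset.range n,
      ((1 - (q : ℂ) ^ (2 * k + 2) * cexp w) * (1 - (q : ℂ) ^ (2 * k + 2) * cexp (-w))) =
    ∑' i : ℤ, (-1) ^ i * cexp (L * (i ^ 2 - i) - i * w) * (qc q n i : ℂ) := by
  have hY := qbinom q (2 * n + 1) (-cexp (-(2 * n + 1) * L - w))
  rw [show 2 * n + 1 = n + (n + 1) by omega, Finset.prod_range_add, Finset.prod_range_succ' _ n] at hY
  have hr := refl_prod h0 L w hL n
  have e1 : ∀ k, 1 + (q : ℂ) ^ (2 * k + 1) * -cexp (-(2 * n + 1) * L - w) =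
      1 - (q : ℂ) ^ (2 * k + 1) * cexp (-(2 * n + 1) * L - w) := fun k => by ring
  have e2 : ∀ k, (q : ℂ) ^ (2 * (n + k) + 1) * cexp (-(2 * n + 1) * L - w) =
      (q : ℂ) ^ (2 * k) * cexp (-w) := fun k => by
    rw [hL, ← Complex.exp_nat_mul, ← Complex.exp_nat_mul, ← Complex.exp_add, ← Complex.exp_add]
    congr 1; push_cast; ring
  simp only [e1, e2] at hY
  have hinj : Function.Injective fun j : ℕ => (j : ℤ) - n := fun a b h => by
    simp only at h; omega
  rw [Finset.prod_mul_distrib, ← hr, ← hinj.tsum_eq, tsum_eq_sum (s := Finset.range (n + (n + 1) + 1))]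
  · have hsum : ∀ j ∈ Finset.range (n + (n + 1) + 1),
        (-1 : ℂ) ^ ((j : ℤ) - n) * cexp (L * ((((j : ℤ) - n : ℤ) : ℂ) ^ 2 - (((j : ℤ) - n : ℤ) : ℂ))
          - (((j : ℤ) - n : ℤ) : ℂ) * w) * (qc q n ((j : ℤ) - n) : ℂ) =
        ((q : ℂ) ^ (j ^ 2) * (qG q (n + (n + 1)) j : ℂ) * (-cexp (-(2 * n + 1) * L - w)) ^ j) *
        ((-1) ^ n * cexp (L * (n ^ 2 + n) + n * w)) := by
      intro j _
      rw [qc, if_pos (by omega), show ((n : ℤ) + ((j : ℤ) - n)).toNat = j by omega,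
        show 2 * n + 1 = n + (n + 1) by omega, zpow_sub₀ (by norm_num), neg_pow (cexp _),
        zpow_natCast, zpow_natCast, hL, ← Complex.exp_nat_mul, ← Complex.exp_nat_mul]
      have s1 : (-1 : ℂ) ^ j / (-1) ^ n = (-1) ^ j * (-1) ^ n := by
        rw [div_eq_iff (by simp), mul_assoc, ← mul_pow]; simp
      rw [s1]
      have s2 : cexp (L * ((((j : ℤ) - n : ℤ) : ℂ) ^ 2 - (((j : ℤ) - n : ℤ) : ℂ))
          - (((j : ℤ) - n : ℤ) : ℂ) * w) = cexp (((j ^ 2 : ℕ) : ℂ) * L) *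
          cexp ((j : ℂ) * (-(2 * n + 1) * L - w)) * cexp (L * (n ^ 2 + n) + n * w) := by
        rw [← Complex.exp_add, ← Complex.exp_add]; congr 1; push_cast; ring
      rw [s2]; ring
    rw [Finset.sum_congr rfl hsum, ← Finset.sum_mul, ← hY]
    simp only [mul_add, mul_one, mul_zero, pow_zero, one_mul]
    ring
  · intro j hj
    rw [Finset.mem_range] at hj
    rw [qc, if_pos (by omega), qG_eq_zero _ _ _ (by omega)]; simp
  · intro i hi
    rw [Function.mem_support] at hi
    by_cases h : 0 ≤ (n : ℤ) + i
    · exact ⟨((n : ℤ) + i).toNat, by simp only; omega⟩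
    · exact absurd (by rw [qc, if_neg h]; simp) hi

lemma triple {q : ℝ} (h0 : 0 < q) (h1 : q < 1) (x : ℂ) :
    Complex.sin x * ∏' n : ℕ, ((1 - 2 * (q : ℂ) ^ (2 * n + 2) * Complex.cos (2 * x) +
          (q : ℂ) ^ (4 * n + 4)) * (1 - (q : ℂ) ^ (2 * n + 2))) =
      1 / (2 * I) * ∑' i, thT (Real.log q) (-I) x i := by
  have hL : (q : ℂ) = cexp (Real.log q) := by
    rw [← Complex.ofReal_exp, Real.exp_log h0]
  have hLre : ((Real.log q : ℝ) : ℂ).re < 0 := by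
    rw [Complex.ofReal_re]; exact Real.log_neg h0 h1
  obtain ⟨P, hP, hle, ht⟩ := qp_lim h0 h1
  have hsc : Summable fun n : ℕ => ‖(q : ℂ) ^ (2 * n + 2)‖ := by
    refine (summable_qpow h0 h1).congr fun n => ?_
    rw [norm_pow, Complex.norm_real, Real.norm_of_nonneg h0.le]
  have hfac : ∀ n : ℕ, (1 - 2 * (q : ℂ) ^ (2 * n + 2) * Complex.cos (2 * x) +
      (q : ℂ) ^ (4 * n + 4)) * (1 - (q : ℂ) ^ (2 * n + 2)) =
      (1 + -(q : ℂ) ^ (2 * n + 2) * cexp (2 * I * x)) *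
      (1 + -(q : ℂ) ^ (2 * n + 2) * cexp (-(2 * I * x))) * (1 + -(q : ℂ) ^ (2 * n + 2)) := by
    intro n
    have hc : 2 * Complex.cos (2 * x) = cexp (2 * I * x) + cexp (-(2 * I * x)) := by
      rw [Complex.two_cos]; congr 2 <;> ring
    have hm : cexp (2 * I * x) * cexp (-(2 * I * x)) = 1 := by
      rw [← Complex.exp_add]; simp
    linear_combination (1 - (q : ℂ) ^ (2 * n + 2)) * (-(q : ℂ) ^ (2 * n + 2) * hc -
      (q : ℂ) ^ (4 * n + 4) * hm)
  have hmul : ∀ c : ℂ, Multipliable fun n : ℕ => 1 + -(q : ℂ) ^ (2 * n + 2) * c := fun c =>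
    multipliable_one_add_of_summable (by
      simp only [norm_mul, norm_neg]; exact hsc.mul_right _)
  have hmul1 : Multipliable fun n : ℕ => 1 + -(q : ℂ) ^ (2 * n + 2) := by
    simpa using hmul 1
  have hM := ((hmul (cexp (2 * I * x))).mul (hmul (cexp (-(2 * I * x))))).mul hmul1
  simp only [hfac]
  have t1 := (hM.hasProd.tendsto_prod_nat).const_mul (Complex.sin x)
  -- the series side
  have hbd : ∀ n i, ‖thT (Real.log q) (-I) x i * (qc q n i : ℂ)‖ ≤
      ‖thT (Real.log q) (-I) x i‖ * (1 / P ^ 2) := fun n i => by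
    rw [norm_mul, Complex.norm_real]
    exact mul_le_mul_of_nonneg_left (qc_bound h0 h1 hP hle n i) (norm_nonneg _)
  have t2 : Filter.Tendsto (fun n => ∑' i, thT (Real.log q) (-I) x i * (qc q n i : ℂ)) Filter.atTop
      (nhds (∑' i, thT (Real.log q) (-I) x i * ((1 / P : ℝ) : ℂ))) := by
    refine tendsto_tsum_of_dominated_convergence
      (((summable_thT (Real.log q) (-I) x hLre).norm).mul_right (1 / P ^ 2)) ?_ ?_
    · intro i
      exact ((Complex.continuous_ofReal.tendsto _).comp (qc_tendsto h0 h1 hP ht i)).const_mul _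
    · exact Filter.Eventually.of_forall fun n i => hbd n i
  have t3 : Filter.Tendsto (fun n => ((qp q n : ℝ) : ℂ)) Filter.atTop (nhds (P : ℂ)) :=
    (Complex.continuous_ofReal.tendsto _).comp ht
  have t4 := (t2.mul t3).const_mul (1 / (2 * I))
  have hPc : (P : ℂ) ≠ 0 := by exact_mod_cast hP.ne'
  have hend : 1 / (2 * I) * ((∑' i, thT (Real.log q) (-I) x i * ((1 / P : ℝ) : ℂ)) * P) =
      1 / (2 * I) * ∑' i, thT (Real.log q) (-I) x i := by
    rw [tsum_mul_right]; push_cast; field_simp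
  rw [hend] at t4
  refine tendsto_nhds_unique t1 (t4.congr fun n => ?_)
  have hf := finite_triple h0 (Real.log q) (2 * I * x) hL n
  have hT : ∀ i : ℤ, thT (Real.log q) (-I) x i * (qc q n i : ℂ) = cexp (I * x) *
      ((-1) ^ i * cexp (Real.log q * (i ^ 2 - i) - i * (2 * I * x)) * (qc q n i : ℂ)) := fun i => by
    have : cexp (Real.log q * (i ^ 2 - i) + (2 * i - 1) * (-I) * x) =
        cexp (I * x) * cexp (Real.log q * (i ^ 2 - i) - i * (2 * I * x)) := by
      rw [← Complex.exp_add]; congr 1; ring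
    rw [thT, this]; ring
  simp only [hT]
  rw [tsum_mul_left, ← hf]
  have hsin : Complex.sin x = 1 / (2 * I) * (cexp (I * x) * (1 - cexp (-(2 * I * x)))) := by
    rw [mul_sub, ← Complex.exp_add, show I * x + -(2 * I * x) = -x * I by ring,
      show I * x = x * I by ring, Complex.sin]
    field_simp
    rw [I_sq]; ring
  rw [hsin, Finset.prod_mul_distrib (g := fun k : ℕ => 1 + -(q : ℂ) ^ (2 * k + 2))]
  have hq : ((qp q n : ℝ) : ℂ) = ∏ k ∈ Finset.range n, (1 + -(q : ℂ) ^ (2 * k + 2)) := by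
    rw [qp]; push_cast
    exact Finset.prod_congr rfl fun k _ => by ring
  have hpp : ∏ k ∈ Finset.range n, ((1 - (q : ℂ) ^ (2 * k + 2) * cexp (2 * I * x)) *
      (1 - (q : ℂ) ^ (2 * k + 2) * cexp (-(2 * I * x)))) =
      ∏ k ∈ Finset.range n, ((1 + -(q : ℂ) ^ (2 * k + 2) * cexp (2 * I * x)) *
      (1 + -(q : ℂ) ^ (2 * k + 2) * cexp (-(2 * I * x)))) :=
    Finset.prod_congr rfl fun k _ => by ring
  rw [hq, hpp]
  ring

lemma isTh_brak {q : ℝ} (h0 : 0 < q) (h1 : q < 1) (lam : ℂ) : IsTh (brak q lam) := by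
  have hLre : ((Real.log q : ℝ) : ℂ).re < 0 := by
    rw [Complex.ofReal_re]; exact Real.log_neg h0 h1
  obtain ⟨κ, C, hκ⟩ : ∃ κ C : ℂ, ∀ u, brak q lam u =
      C * ∑' i, thT (Real.log q) (-I) (κ * u) i := by
    refine ⟨Real.pi * lam / (2 * (Kone q : ℂ)), 2 * (q : ℂ) ^ (1 / 4 : ℂ) * (1 / (2 * I)),
      fun u => ?_⟩
    rw [brak, theta, mul_assoc (2 * (q : ℂ) ^ (1 / 4 : ℂ)) (1 / (2 * I)), ← triple h0 h1]
    have a1 : (Real.pi : ℂ) * (lam * u) / (2 * (Kone q : ℂ)) =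
      Real.pi * lam / (2 * (Kone q : ℂ)) * u := by ring
    have a2 : (Real.pi : ℂ) * (lam * u) / (Kone q : ℂ) =
      2 * (Real.pi * lam / (2 * (Kone q : ℂ)) * u) := by ring
    rw [a1, a2, mul_assoc]
  have hadd : ∀ x y, brak q lam (x + y) * brak q lam (x - y) = C ^ 2 *
      ((∑' i, thO (Real.log q) (-I) (κ * x) i) * (∑' i, thE (Real.log q) (-I) (κ * y) i) -
       (∑' i, thE (Real.log q) (-I) (κ * x) i) * (∑' i, thO (Real.log q) (-I) (κ * y) i)) := by
    intro x y
    rw [← thT_addition _ _ _ _ hLre, hκ, hκ, mul_add, mul_sub]; ring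
  constructor
  · intro x
    simp only [brak, theta, mul_neg, neg_div, Complex.sin_neg, Complex.cos_neg, neg_mul]
  · intro a b c d
    rw [mul_assoc, hadd, hadd, mul_assoc (brak q lam (a + c) * _), hadd, hadd,
      mul_assoc (brak q lam (a + d) * _), hadd, hadd]
    ring


/-- the Deguchi–Martin face weights satisfy the face-type Yang–Baxter
(star-triangle) relation; moreover each of the two sums over the inner state vector
`g ∈ ℤ²` has only finitely many nonzero terms. -/
theorem statement4 (q : ℝ) (hq0 : 0 < q) (hq1 : q < 1) (lam : ℂ) (hlam : lam ≠ 0)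
    (ω12 : ℂ)
    (hbr1 : brak q lam 1 ≠ 0)
    (hbrA : ∀ b : ℤ × ℤ, brak q lam (aSc ω12 b) ≠ 0)
    (hbrA' : ∀ b : ℤ × ℤ, brak q lam (-aSc ω12 b) ≠ 0)
    (a b c d e f : ℤ × ℤ) (u1 u2 u3 : ℂ) :
    {g : ℤ × ℤ | faceW q lam ω12 f g a b u1 u3 * faceW q lam ω12 e d f g u2 u3 *
        faceW q lam ω12 d c g b u2 u1 ≠ 0}.Finite ∧
    {g : ℤ × ℤ | faceW q lam ω12 e d g c u1 u3 * faceW q lam ω12 g c a b u2 u3 *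
        faceW q lam ω12 e g f a u2 u1 ≠ 0}.Finite ∧
    ∑' g : ℤ × ℤ, faceW q lam ω12 f g a b u1 u3 * faceW q lam ω12 e d f g u2 u3 *
        faceW q lam ω12 d c g b u2 u1 =
      ∑' g : ℤ × ℤ, faceW q lam ω12 e d g c u1 u3 * faceW q lam ω12 g c a b u2 u3 *
        faceW q lam ω12 e g f a u2 u1 := by
  exact ybe_of_isTh q lam ω12 (isTh_brak hq0 hq1 lam) hbr1 hbrA a b c d e f u1 u2 u3

end
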